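/- Let h₁, h₂ satisfy (H1), (H2), (H3), let l, r satisfy the alignment hypotheses, and fix 𝔯 > 0 small enough that the closed balls of radius 𝔯 around the centers are pairwise disjoint. Then there exist positive constants ϑ₁, η₁, c₁, c₂ and c_*, all independent of α, such that for every α > 0, every ϑ ∈ (0, ϑ₁) and every η ∈ (0, min(η₁, c_* ϑ²)): (i) if x ∈ F_{η,ϑ} then |div g_α(x)| ≤ c₁ · (α n(0)²/(l(0)+α)) · ϑ; (ii) if x ∈ G_{η,ϑ} then div g_α(x) ≥ c₂ · (α n(0)²/(l(0)+α)) · ϑ². -/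

import Mathlib

noncomputable section

/-- (H1): every zero of `h` is simple. -/
def CondH1 (h : ℝ → ℝ) : Prop := ∀ a : ℝ, h a = 0 → deriv h a ≠ 0

/-- (H2): every critical point of `h` is nondegenerate. -/
def CondH2 (h : ℝ → ℝ) : Prop := ∀ b : ℝ, deriv h b = 0 → deriv (deriv h) b ≠ 0

/-- (H3): the convexity-type condition `h·h'' ≤ 0`. -/
def CondH3 (h : ℝ → ℝ) : Prop := ∀ x : ℝ, h x * deriv (deriv h) x ≤ 0

/-- The factorized Hamiltonian `H(x₁,x₂) = h₁(x₁)·h₂(x₂)`. -/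
def Ham (h₁ h₂ : ℝ → ℝ) : ℝ × ℝ → ℝ := fun x => h₁ x.1 * h₂ x.2

/-- The Hamiltonian vector field `ξ = ∇⊥H = (−h₁h₂', h₁'h₂)`. -/
def xiField (h₁ h₂ : ℝ → ℝ) : ℝ × ℝ → ℝ × ℝ :=
  fun x => (-(h₁ x.1 * deriv h₂ x.2), deriv h₁ x.1 * h₂ x.2)

/-- The divergence of a vector field on `ℝ²`. -/
def divR2 (V : ℝ × ℝ → ℝ × ℝ) (x : ℝ × ℝ) : ℝ :=
  (fderiv ℝ V x (1, 0)).1 + (fderiv ℝ V x (0, 1)).2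

/-- The inertial drift `g_α = β_α ν² Dξ ξ` under the alignment condition. -/
def driftG (h₁ h₂ l r : ℝ → ℝ) (α : ℝ) : ℝ × ℝ → ℝ × ℝ := fun x =>
  (α / (2 * (l (Ham h₁ h₂ x) + α)) * (r (Ham h₁ h₂ x) / l (Ham h₁ h₂ x)) ^ 2) •
    fderiv ℝ (xiField h₁ h₂) x (xiField h₁ h₂ x)

/-- The set of centers of `H = h₁h₂`, i.e. `M₁ × M₂`. -/
def centers (h₁ h₂ : ℝ → ℝ) : Set (ℝ × ℝ) :=
  {p : ℝ × ℝ | deriv h₁ p.1 = 0 ∧ deriv h₂ p.2 = 0}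

/-- The set of midpoints of the separatrix: `ℳ = (Z₁ × M₂) ∪ (M₁ × Z₂)`. -/
def midpoints (h₁ h₂ : ℝ → ℝ) : Set (ℝ × ℝ) :=
  {q : ℝ × ℝ | (h₁ q.1 = 0 ∧ deriv h₂ q.2 = 0) ∨ (deriv h₁ q.1 = 0 ∧ h₂ q.2 = 0)}

/-- The thin neighborhood of the separatrix `E_η = {|H| ≤ η}`. -/
def Eset (h₁ h₂ : ℝ → ℝ) (η : ℝ) : Set (ℝ × ℝ) :=
  {x : ℝ × ℝ | |Ham h₁ h₂ x| ≤ η}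

/-- The complement `D_𝔯` of the union of open balls of radius `𝔯` around the
centers. -/
def Dset (h₁ h₂ : ℝ → ℝ) (ρ : ℝ) : Set (ℝ × ℝ) :=
  {x : ℝ × ℝ | ∀ p ∈ centers h₁ h₂, ρ ≤ dist x p}

/-- The bad set `F_{η,ϑ}`: points of `E_η` within distance `ϑ` of a midpoint. -/
def Fset (h₁ h₂ : ℝ → ℝ) (η ϑ : ℝ) : Set (ℝ × ℝ) :=
  ⋃ q ∈ midpoints h₁ h₂, Eset h₁ h₂ η ∩ Metric.ball q ϑ

/-- The good set `G_{η,ϑ} = (E_η ∩ D_𝔯) \ F_{η,ϑ}`. -/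
def Gset (h₁ h₂ : ℝ → ℝ) (ρ η ϑ : ℝ) : Set (ℝ × ℝ) :=
  (Eset h₁ h₂ η ∩ Dset h₁ h₂ ρ) \ Fset h₁ h₂ η ϑ

lemma Function.Periodic.deriv' {f : ℝ → ℝ} {L : ℝ} (h : Function.Periodic f L) :
    Function.Periodic (deriv f) L := by
  intro x
  rw [← deriv_comp_add_const]
  congr 1
  exact funext h

lemma Function.Periodic.exists_abs_le {f : ℝ → ℝ} {L : ℝ} (hp : Function.Periodic f L)
    (hL : L ≠ 0) (hf : Continuous f) : ∃ K : ℝ, ∀ x, |f x| ≤ K := by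
  obtain ⟨K, hK⟩ := (hp.isBounded_of_continuous hL hf).exists_norm_le
  exact ⟨K, fun x => hK _ ⟨x, rfl⟩⟩

lemma Function.Periodic.exists_pos_le {f : ℝ → ℝ} {L : ℝ} (hp : Function.Periodic f L)
    (hL : L ≠ 0) (hf : Continuous f) (hpos : ∀ x, 0 < f x) : ∃ m : ℝ, 0 < m ∧ ∀ x, m ≤ f x := by
  obtain ⟨_, ⟨x, rfl⟩, hx⟩ :=
    (hp.compact_of_continuous hL hf).exists_isLeast (Set.range_nonempty f)
  exact ⟨f x, hpos x, fun y => hx ⟨y, rfl⟩⟩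

/-- A quantitative intermediate value statement: if `f' ≥ m` on `[x - δ, x + δ]` and `|f x| < m δ`,
then `f` has a zero within distance `|f x| / m` of `x`. -/
lemma exists_zero_near {f : ℝ → ℝ} (hf : Differentiable ℝ f) {m δ x : ℝ}
    (hδ : 0 < δ) (hd : ∀ y ∈ Set.Icc (x - δ) (x + δ), m ≤ deriv f y) (hx : |f x| < m * δ) :
    ∃ z, f z = 0 ∧ m * |x - z| ≤ |f x| := by
  have key : ∀ y ∈ Set.Icc (x - δ) (x + δ), ∀ z ∈ Set.Icc (x - δ) (x + δ), y ≤ z →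
      m * (z - y) ≤ f z - f y :=
    (convex_Icc _ _).mul_sub_le_image_sub_of_le_deriv hf.continuous.continuousOn
      hf.differentiableOn (fun y hy => hd y (interior_subset hy))
  have hxm : x ∈ Set.Icc (x - δ) (x + δ) := ⟨by linarith, by linarith⟩
  have h1 := key (x - δ) ⟨le_rfl, by linarith⟩ x hxm (by linarith)
  have h2 := key x hxm (x + δ) ⟨by linarith, le_rfl⟩ (by linarith)
  rw [abs_lt] at hx
  obtain ⟨z, hz, hz0⟩ := intermediate_value_Icc (by linarith : x - δ ≤ x + δ)
    hf.continuous.continuousOn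
    (show (0 : ℝ) ∈ Set.Icc (f (x - δ)) (f (x + δ)) from ⟨by linarith, by linarith⟩)
  refine ⟨z, hz0, ?_⟩
  rcases le_total x z with h | h
  · have := key x hxm z hz h
    rw [abs_sub_comm, abs_of_nonneg (sub_nonneg.2 h)]
    linarith [neg_abs_le (f x)]
  · have := key z hz x hxm h
    rw [abs_of_nonneg (sub_nonneg.2 h)]
    linarith [le_abs_self (f x)]

lemma abs_deriv_sub_le {f : ℝ → ℝ} (hf : Differentiable ℝ f) {K : ℝ} (hK : ∀ x, |deriv f x| ≤ K)
    (x y : ℝ) : |f x - f y| ≤ K * |x - y| :=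
  convex_univ.norm_image_sub_le_of_norm_deriv_le (fun z _ => hf z) (fun z _ => hK z)
    (Set.mem_univ y) (Set.mem_univ x)

/-- `f` controls, with constant `m`, the distance to its zeros, and `|f'| ≥ m` wherever
`|f| < m`. -/
def ZeroControl (f : ℝ → ℝ) (m : ℝ) : Prop :=
  ∀ x, |f x| < m → m ≤ |deriv f x| ∧ ∃ z, f z = 0 ∧ m * |x - z| ≤ |f x|

lemma ZeroControl.mono {f : ℝ → ℝ} {m m' : ℝ} (h : ZeroControl f m) (hm : m' ≤ m) :
    ZeroControl f m' := by
  intro x hx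
  obtain ⟨h1, z, hz, h2⟩ := h x (hx.trans_le hm)
  exact ⟨hm.trans h1, z, hz, (mul_le_mul_of_nonneg_right hm (abs_nonneg _)).trans h2⟩

lemma exists_zeroControl {f : ℝ → ℝ} {L : ℝ} (hL : L ≠ 0) (hf : ContDiff ℝ 2 f)
    (hp : Function.Periodic f L) (hs : ∀ a, f a = 0 → deriv f a ≠ 0) :
    ∃ m, 0 < m ∧ ZeroControl f m := by
  have hf' : ContDiff ℝ 1 (deriv f) := hf.deriv'
  have hf'' : ContDiff ℝ 0 (deriv (deriv f)) := hf'.deriv'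
  have hd := hf.differentiable (by norm_num)
  have hd' := hf'.differentiable (by norm_num)
  obtain ⟨m, hm, hmle⟩ := Function.Periodic.exists_pos_le (f := fun x => |f x| + |deriv f x|)
    (L := L) (fun x => by simp only [hp x, hp.deriv' x]) hL
    (hf.continuous.abs.add hf'.continuous.abs) (fun x => by
      by_cases h : f x = 0
      · have := abs_pos.2 (hs x h)
        positivity
      · have := abs_pos.2 h
        positivity)
  obtain ⟨K₀, hK₀⟩ := hp.deriv'.deriv'.exists_abs_le hL hf''.continuous
  obtain ⟨K, hK0, hK⟩ : ∃ K : ℝ, 0 < K ∧ ∀ x, |deriv (deriv f) x| ≤ K :=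
    ⟨max K₀ 1, by positivity, fun x => (hK₀ x).trans (le_max_left _ _)⟩
  have hlip := abs_deriv_sub_le hd' hK
  set μ := m / 4 with hμ
  have hμ0 : 0 < μ := by positivity
  set δ := μ / K with hδ
  have hδ0 : 0 < δ := by positivity
  have hKδ : K * δ = μ := by rw [hδ]; field_simp
  have near : ∀ x y, y ∈ Set.Icc (x - δ) (x + δ) → |deriv f y - deriv f x| ≤ μ := by
    intro x y hy
    rw [← hKδ]
    refine (hlip y x).trans (mul_le_mul_of_nonneg_left ?_ hK0.le)
    rw [abs_le]
    constructor <;> linarith [hy.1, hy.2]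
  refine ⟨min μ (μ * δ), by positivity, fun x hx => ?_⟩
  obtain ⟨hx1, hx2⟩ := lt_min_iff.1 hx
  have hbig : 2 * μ ≤ |deriv f x| := by linarith [hmle x]
  refine ⟨(min_le_left _ _).trans (by linarith), ?_⟩
  suffices ∃ z, f z = 0 ∧ μ * |x - z| ≤ |f x| by
    obtain ⟨z, hz, h⟩ := this
    exact ⟨z, hz, (mul_le_mul_of_nonneg_right (min_le_left _ _) (abs_nonneg _)).trans h⟩
  rcases le_abs.1 hbig with h | h
  · refine exists_zero_near hd hδ0 (fun y hy => ?_) hx2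
    linarith [(abs_le.1 (near x y hy)).1]
  · obtain ⟨z, hz, h'⟩ := exists_zero_near (f := -f) (m := μ) (x := x) hd.neg hδ0 (fun y hy => by
      rw [deriv.neg]
      linarith [(abs_le.1 (near x y hy)).2]) (by simpa using hx2)
    exact ⟨z, by simpa using hz, by simpa using h'⟩

/-- The scalar prefactor `β_α ν²` of the drift, as a function of the value of `H`. -/
def driftCoeff (l r : ℝ → ℝ) (α s : ℝ) : ℝ := α / (2 * (l s + α)) * (r s / l s) ^ 2

lemma exists_abs_le_Icc {f : ℝ → ℝ} (hf : Continuous f) :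
    ∃ K : ℝ, 0 < K ∧ ∀ s ∈ Set.Icc (-1 : ℝ) 1, |f s| ≤ K := by
  obtain ⟨K, hK⟩ := isCompact_Icc.exists_bound_of_continuousOn (s := Set.Icc (-1 : ℝ) 1)
    hf.continuousOn
  exact ⟨max K 1, by positivity, fun s hs => (hK s hs).trans (le_max_left _ _)⟩

lemma driftCoeff_bounds {l r : ℝ → ℝ} {l₀ r₀ : ℝ} (hl₀ : 0 < l₀) (hr₀ : 0 < r₀)
    (hl : ContDiff ℝ 1 l) (hr : ContDiff ℝ 1 r)
    (hlb : ∀ s ∈ Set.Icc (-1 : ℝ) 1, l₀ ≤ l s) (hrb : ∀ s ∈ Set.Icc (-1 : ℝ) 1, r₀ ≤ (r s) ^ 2) :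
    ∃ c C : ℝ, 0 < c ∧ 0 < C ∧ ∀ α, 0 < α → ∀ s ∈ Set.Icc (-1 : ℝ) 1,
      c * (α * (r 0 / l 0) ^ 2 / (l 0 + α)) ≤ driftCoeff l r α s ∧
      driftCoeff l r α s ≤ C * (α * (r 0 / l 0) ^ 2 / (l 0 + α)) ∧
      ∃ d, HasDerivAt (driftCoeff l r α) d s ∧
        |d| ≤ C * (α * (r 0 / l 0) ^ 2 / (l 0 + α)) := by
  have h0 : (0 : ℝ) ∈ Set.Icc (-1 : ℝ) 1 := by norm_num
  have hl0 : 0 < l 0 := hl₀.trans_le (hlb 0 h0)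
  have hr0 : 0 < r 0 ^ 2 := hr₀.trans_le (hrb 0 h0)
  obtain ⟨Λ, hΛ, hlΛ⟩ := exists_abs_le_Icc hl.continuous
  obtain ⟨R, hR, hrR⟩ := exists_abs_le_Icc hr.continuous
  obtain ⟨D, hD, hlD⟩ := exists_abs_le_Icc (hl.continuous_deriv le_rfl)
  obtain ⟨S, hS, hrS⟩ := exists_abs_le_Icc (hr.continuous_deriv le_rfl)
  obtain ⟨N, hN, hN0⟩ : ∃ N, 0 < N ∧ (r 0 / l 0) ^ 2 = N := ⟨_, by rw [div_pow]; positivity, rfl⟩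
  set C₁ := (R / l₀) ^ 2 with hC₁
  set C₂ := 2 * (R / l₀) * ((S * Λ + R * D) / l₀ ^ 2) with hC₂
  refine ⟨l₀ / Λ / 2 * (r₀ / Λ ^ 2) / N,
    Λ / l₀ * (C₁ + C₂ + D / l₀ * C₁) / N, by positivity, by positivity, fun α hα s hs => ?_⟩
  rw [hN0]
  have hls : l₀ ≤ l s := hlb s hs
  have hls0 : 0 < l s := hl₀.trans_le hls
  have hlsΛ : l s ≤ Λ := (le_abs_self _).trans (hlΛ s hs)
  have hl0Λ : l 0 ≤ Λ := (le_abs_self _).trans (hlΛ 0 h0)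
  have hl₀Λ : l₀ ≤ Λ := hls.trans hlsΛ
  set q := α / (l s + α) with hq
  have hq0 : 0 < q := by positivity
  set A := α / (l 0 + α) with hA
  have hA0 : 0 < A := by positivity
  have hAN : α * N / (l 0 + α) = A * N := by rw [hA]; ring
  have hqA : q ≤ Λ / l₀ * A := by
    rw [hq, hA, div_mul_div_comm, div_le_div_iff₀ (by positivity) (by positivity)]
    have : l₀ * (l 0 + α) ≤ Λ * (l s + α) := by
      nlinarith [mul_le_mul_of_nonneg_left hls hΛ.le, mul_le_mul_of_nonneg_left hl0Λ hl₀.le]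
    nlinarith
  have hAq : l₀ / Λ * A ≤ q := by
    rw [hq, hA, div_mul_div_comm, div_le_div_iff₀ (by positivity) (by positivity)]
    have : l₀ * (l s + α) ≤ Λ * (l 0 + α) := by
      nlinarith [mul_le_mul_of_nonneg_left hlsΛ hl₀.le,
        mul_le_mul_of_nonneg_left (hlb 0 h0) hΛ.le]
    nlinarith
  have hP1 : (r s / l s) ^ 2 ≤ C₁ := by
    rw [hC₁, ← sq_abs (r s / l s), abs_div, abs_of_pos hls0]
    have := hrR s hs
    gcongr
  have hP2 : r₀ / Λ ^ 2 ≤ (r s / l s) ^ 2 := by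
    rw [div_pow]
    have := hrb s hs
    gcongr
  have hP0 : 0 ≤ (r s / l s) ^ 2 := sq_nonneg _
  have hφ : driftCoeff l r α s = q / 2 * (r s / l s) ^ 2 := by
    rw [driftCoeff, hq]; field_simp
  rw [hφ, hAN]
  have e1 : Λ / l₀ * (C₁ + C₂ + D / l₀ * C₁) / N * (A * N)
      = (Λ / l₀ * A) * (C₁ + C₂ + D / l₀ * C₁) := by field_simp
  have e2 : l₀ / Λ / 2 * (r₀ / Λ ^ 2) / N * (A * N) = (l₀ / Λ * A) / 2 * (r₀ / Λ ^ 2) := by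
    field_simp
  have hC₁0 : 0 < C₁ := by positivity
  have hC₂0 : 0 < C₂ := by positivity
  rw [e1, e2]
  refine ⟨by gcongr, ?_, ?_⟩
  · calc q / 2 * (r s / l s) ^ 2 ≤ q * C₁ := by
          gcongr; linarith
      _ ≤ q * (C₁ + C₂ + D / l₀ * C₁) := by
          gcongr
          have : 0 < D / l₀ * C₁ := by positivity
          linarith
      _ ≤ _ := by gcongr
  · have dl := (hl.differentiable (by norm_num) s).hasDerivAt
    have dr := (hr.differentiable (by norm_num) s).hasDerivAt
    have d1 := (((dl.add_const α).const_mul 2).inv (by positivity)).const_mul α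
    have d2 := (dr.div dl hls0.ne').pow 2
    have d3 : HasDerivAt (driftCoeff l r α) _ s := d1.mul d2
    refine ⟨q / 2 * (2 * (r s / l s) * ((deriv r s * l s - r s * deriv l s) / l s ^ 2))
        - q / 2 * (deriv l s / (l s + α)) * (r s / l s) ^ 2, ?_, ?_⟩
    · refine d3.congr_deriv ?_
      have hq' : q / 2 = α * (2 * (l s + α))⁻¹ := by rw [hq]; field_simp
      simp only [hq', Pi.div_apply, Pi.inv_apply, Nat.add_one_sub_one, pow_one, Nat.cast_ofNat]
      field_simp
      ring
    · have b1 : |r s / l s| ≤ R / l₀ := by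
        rw [abs_div, abs_of_pos hls0]
        have := hrR s hs
        gcongr
      have b2 : |(deriv r s * l s - r s * deriv l s) / l s ^ 2| ≤ (S * Λ + R * D) / l₀ ^ 2 := by
        rw [abs_div, abs_of_pos (by positivity : 0 < l s ^ 2)]
        have : |deriv r s * l s - r s * deriv l s| ≤ S * Λ + R * D := by
          refine (abs_sub _ _).trans ?_
          rw [abs_mul, abs_mul]
          have := hrS s hs
          have := hlΛ s hs
          have := hrR s hs
          have := hlD s hs
          gcongr
        gcongr
      have b3 : |deriv l s / (l s + α)| ≤ D / l₀ := by
        rw [abs_div, abs_of_pos (by positivity : 0 < l s + α)]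
        have := hlD s hs
        gcongr
        linarith
      calc _ ≤ q / 2 * C₂ + q / 2 * (D / l₀) * C₁ := by
            refine (abs_sub _ _).trans ?_
            simp only [abs_mul, abs_of_pos (half_pos hq0), abs_of_nonneg hP0, abs_two]
            rw [hC₂]
            gcongr
        _ ≤ q * (C₁ + C₂ + D / l₀ * C₁) := by
            have : 0 < q * C₁ := by positivity
            have : 0 < q * C₂ := by positivity
            have : 0 < q * (D / l₀ * C₁) := by positivity
            linarith
        _ ≤ _ := by gcongr

lemma fderiv_xiField_apply {h₁ h₂ : ℝ → ℝ} (hreg₁ : ContDiff ℝ 2 h₁) (hreg₂ : ContDiff ℝ 2 h₂)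
    (x : ℝ × ℝ) : fderiv ℝ (xiField h₁ h₂) x (xiField h₁ h₂ x) =
      (h₁ x.1 * deriv h₁ x.1 * (deriv h₂ x.2 ^ 2 - h₂ x.2 * deriv (deriv h₂) x.2),
        h₂ x.2 * deriv h₂ x.2 * (deriv h₁ x.1 ^ 2 - h₁ x.1 * deriv (deriv h₁) x.1)) := by
  have d1 : ∀ {h : ℝ → ℝ}, ContDiff ℝ 2 h → ∀ t, HasDerivAt h (deriv h t) t := fun hh t =>
    (hh.differentiable (by norm_num) t).hasDerivAt
  have d2 : ∀ {h : ℝ → ℝ}, ContDiff ℝ 2 h → ∀ t, HasDerivAt (deriv h) (deriv (deriv h) t) t :=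
    fun hh t => ((ContDiff.deriv' (n := 1) hh).differentiable (by norm_num) t).hasDerivAt
  have f1 : HasFDerivAt (fun x : ℝ × ℝ => x.1) (ContinuousLinearMap.fst ℝ ℝ ℝ) x := hasFDerivAt_fst
  have f2 : HasFDerivAt (fun x : ℝ × ℝ => x.2) (ContinuousLinearMap.snd ℝ ℝ ℝ) x := hasFDerivAt_snd
  have a := (d1 hreg₁ x.1).comp_hasFDerivAt x f1
  have a' := (d2 hreg₁ x.1).comp_hasFDerivAt x f1
  have b := (d1 hreg₂ x.2).comp_hasFDerivAt x f2
  have b' := (d2 hreg₂ x.2).comp_hasFDerivAt x f2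
  have h : HasFDerivAt (xiField h₁ h₂) _ x := (a.mul b').neg.prodMk (a'.mul b)
  rw [h.fderiv]
  ext <;> simp [xiField] <;> ring

lemma divR2_eq {V : ℝ × ℝ → ℝ × ℝ} {x : ℝ × ℝ} (hV : DifferentiableAt ℝ V x) {u v : ℝ}
    (hu : HasDerivAt (fun t => (V (t, x.2)).1) u x.1)
    (hv : HasDerivAt (fun t => (V (x.1, t)).2) v x.2) : divR2 V x = u + v := by
  have e1 : HasDerivAt (fun t => V (t, x.2)) (fderiv ℝ V x (1, 0)) x.1 :=
    HasFDerivAt.comp_hasDerivAt (f := fun t : ℝ => (t, x.2)) x.1 hV.hasFDerivAt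
      ((hasDerivAt_id x.1).prodMk (hasDerivAt_const x.1 x.2))
  have e2 : HasDerivAt (fun t => V (x.1, t)) (fderiv ℝ V x (0, 1)) x.2 :=
    HasFDerivAt.comp_hasDerivAt (f := fun t : ℝ => (x.1, t)) x.2 hV.hasFDerivAt
      ((hasDerivAt_const x.2 x.1).prodMk (hasDerivAt_id x.2))
  have g1 : HasDerivAt (fun t => (V (t, x.2)).1) (fderiv ℝ V x (1, 0)).1 x.1 :=
    HasFDerivAt.comp_hasDerivAt (l := Prod.fst) (l' := ContinuousLinearMap.fst ℝ ℝ ℝ) x.1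
      hasFDerivAt_fst e1
  have g2 : HasDerivAt (fun t => (V (x.1, t)).2) (fderiv ℝ V x (0, 1)).2 x.2 :=
    HasFDerivAt.comp_hasDerivAt (l := Prod.snd) (l' := ContinuousLinearMap.snd ℝ ℝ ℝ) x.2
      hasFDerivAt_snd e2
  rw [divR2, g1.unique hu, g2.unique hv]

lemma divR2_driftG {h₁ h₂ l r : ℝ → ℝ} {α d : ℝ} (hreg₁ : ContDiff ℝ 3 h₁)
    (hreg₂ : ContDiff ℝ 3 h₂) {x : ℝ × ℝ}
    (hd : HasDerivAt (driftCoeff l r α) d (Ham h₁ h₂ x)) :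
    divR2 (driftG h₁ h₂ l r α) x =
      d * (h₁ x.1 * h₂ x.2 *
          (deriv h₁ x.1 ^ 2 * (deriv h₂ x.2 ^ 2 - h₂ x.2 * deriv (deriv h₂) x.2) +
            deriv h₂ x.2 ^ 2 * (deriv h₁ x.1 ^ 2 - h₁ x.1 * deriv (deriv h₁) x.1))) +
        driftCoeff l r α (Ham h₁ h₂ x) *
          (2 * (deriv h₁ x.1 * deriv h₂ x.2) ^ 2 -
            2 * (h₁ x.1 * h₂ x.2) * (deriv (deriv h₁) x.1 * deriv (deriv h₂) x.2)) := by
  have hc₁ : ContDiff ℝ 2 (deriv h₁) := ContDiff.deriv' (n := 2) hreg₁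
  have hc₂ : ContDiff ℝ 2 (deriv h₂) := ContDiff.deriv' (n := 2) hreg₂
  have hcc₁ : ContDiff ℝ 1 (deriv (deriv h₁)) := ContDiff.deriv' (n := 1) hc₁
  have hcc₂ : ContDiff ℝ 1 (deriv (deriv h₂)) := ContDiff.deriv' (n := 1) hc₂
  have D₁ : Differentiable ℝ h₁ := hreg₁.differentiable (by norm_num)
  have D₂ : Differentiable ℝ h₂ := hreg₂.differentiable (by norm_num)
  have D₁' : Differentiable ℝ (deriv h₁) := hc₁.differentiable (by norm_num)
  have D₂' : Differentiable ℝ (deriv h₂) := hc₂.differentiable (by norm_num)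
  have D₁'' : Differentiable ℝ (deriv (deriv h₁)) := hcc₁.differentiable (by norm_num)
  have D₂'' : Differentiable ℝ (deriv (deriv h₂)) := hcc₂.differentiable (by norm_num)
  have hV : driftG h₁ h₂ l r α = fun x =>
      (driftCoeff l r α (Ham h₁ h₂ x) *
        (h₁ x.1 * deriv h₁ x.1 * (deriv h₂ x.2 ^ 2 - h₂ x.2 * deriv (deriv h₂) x.2)),
      driftCoeff l r α (Ham h₁ h₂ x) *
        (h₂ x.2 * deriv h₂ x.2 * (deriv h₁ x.1 ^ 2 - h₁ x.1 * deriv (deriv h₁) x.1))) := by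
    funext y
    rw [driftG, fderiv_xiField_apply (hreg₁.of_le (by norm_num)) (hreg₂.of_le (by norm_num))]
    rfl
  have hcomp : DifferentiableAt ℝ (fun y => driftCoeff l r α (Ham h₁ h₂ y)) x := by
    refine hd.differentiableAt.comp x ?_
    unfold Ham
    fun_prop
  have u1 : HasDerivAt (fun t => driftCoeff l r α (h₁ t * h₂ x.2))
      (d * (deriv h₁ x.1 * h₂ x.2)) x.1 :=
    HasDerivAt.comp (h₂ := driftCoeff l r α) x.1 hd ((D₁ x.1).hasDerivAt.mul_const (h₂ x.2))
  have u2 : HasDerivAt (fun t => driftCoeff l r α (h₁ x.1 * h₂ t))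
      (d * (h₁ x.1 * deriv h₂ x.2)) x.2 :=
    HasDerivAt.comp (h₂ := driftCoeff l r α) x.2 hd ((D₂ x.2).hasDerivAt.const_mul (h₁ x.1))
  have v1 := u1.mul (((D₁ x.1).hasDerivAt.mul (D₁' x.1).hasDerivAt).mul_const
    (deriv h₂ x.2 ^ 2 - h₂ x.2 * deriv (deriv h₂) x.2))
  have v2 := u2.mul (((D₂ x.2).hasDerivAt.mul (D₂' x.2).hasDerivAt).mul_const
    (deriv h₁ x.1 ^ 2 - h₁ x.1 * deriv (deriv h₁) x.1))
  have hdiff : DifferentiableAt ℝ (driftG h₁ h₂ l r α) x := by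
    rw [hV]
    exact DifferentiableAt.prodMk (hcomp.mul (by fun_prop)) (hcomp.mul (by fun_prop))
  rw [divR2_eq hdiff (by rw [hV]; exact v1) (by rw [hV]; exact v2)]
  simp only [Ham, Pi.mul_apply]
  ring

/-- Away from the product of the zeros of `f` and the critical points of `g`, smallness of `f`
forces `f' g'` to be bounded below. -/
lemma le_abs_deriv_mul_deriv {f g : ℝ → ℝ} {m ϑ s t : ℝ} (hm : 0 < m) (hϑ : 0 < ϑ)
    (hϑ1 : ϑ < 1) (hf : ZeroControl f m) (hg : ZeroControl (deriv g) m)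
    (hs : |f s| < m * ϑ)
    (hfar : ∀ z c, f z = 0 → deriv g c = 0 → |s - z| < ϑ → ϑ ≤ |t - c|) :
    m ^ 2 * ϑ ≤ |deriv f s * deriv g t| := by
  have hmϑ : m * ϑ < m := by nlinarith
  obtain ⟨h1, z, hz, h2⟩ := hf s (hs.trans hmϑ)
  have hsz : |s - z| < ϑ := lt_of_mul_lt_mul_left (h2.trans_lt hs) hm.le
  have h3 : m * ϑ ≤ |deriv g t| := by
    by_contra! h
    obtain ⟨-, c, hc, h4⟩ := hg t (h.trans hmϑ)
    have := hfar z c hz hc hsz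
    nlinarith
  rw [abs_mul]
  calc m ^ 2 * ϑ = m * (m * ϑ) := by ring
    _ ≤ _ := by gcongr

/-- Sign-control dichotomy for `div g_α`: there exist `ϑ₁, η₁, c₁, c₂, c_* > 0`,
independent of `α`, such that for all `α > 0`, `ϑ ∈ (0,ϑ₁)` and
`η ∈ (0, min(η₁, c_* ϑ²))`, `|div g_α| ≤ c₁ (α n(0)²/(l(0)+α)) ϑ` on `F_{η,ϑ}`
and `div g_α ≥ c₂ (α n(0)²/(l(0)+α)) ϑ²` on `G_{η,ϑ}`. -/
theorem div_drift_dichotomy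
    (L l₀ r₀ : ℝ) (hL : 0 < L) (hl₀ : 0 < l₀) (hr₀ : 0 < r₀)
    (h₁ h₂ : ℝ → ℝ)
    (hreg₁ : ContDiff ℝ 3 h₁) (hreg₂ : ContDiff ℝ 3 h₂)
    (hper₁ : Function.Periodic h₁ L) (hper₂ : Function.Periodic h₂ L)
    (hbd₁ : ∀ x : ℝ, |h₁ x| ≤ 1) (hbd₂ : ∀ x : ℝ, |h₂ x| ≤ 1)
    (hmax₁ : ∃ x : ℝ, |h₁ x| = 1) (hmax₂ : ∃ x : ℝ, |h₂ x| = 1)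
    (hH1₁ : CondH1 h₁) (hH1₂ : CondH1 h₂)
    (hH2₁ : CondH2 h₁) (hH2₂ : CondH2 h₂)
    (hH3₁ : CondH3 h₁) (hH3₂ : CondH3 h₂)
    (l r : ℝ → ℝ) (hlreg : ContDiff ℝ 2 l) (hrreg : ContDiff ℝ 2 r)
    (hlb : ∀ s ∈ Set.Icc (-1 : ℝ) 1, l₀ ≤ l s)
    (hrb : ∀ s ∈ Set.Icc (-1 : ℝ) 1, r₀ ≤ (r s) ^ 2)
    (ρ : ℝ) (hρ : 0 < ρ)
    (hdisj : ∀ p ∈ centers h₁ h₂, ∀ q ∈ centers h₁ h₂, p ≠ q →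
      Disjoint (Metric.closedBall p ρ) (Metric.closedBall q ρ)) :
    ∃ ϑ₁ η₁ c₁ c₂ cstar : ℝ,
      0 < ϑ₁ ∧ 0 < η₁ ∧ 0 < c₁ ∧ 0 < c₂ ∧ 0 < cstar ∧
      ∀ α : ℝ, 0 < α →
      ∀ ϑ : ℝ, 0 < ϑ → ϑ < ϑ₁ →
      ∀ η : ℝ, 0 < η → η < min η₁ (cstar * ϑ ^ 2) →
      ∀ x : ℝ × ℝ,
        (x ∈ Fset h₁ h₂ η ϑ →
          |divR2 (driftG h₁ h₂ l r α) x| ≤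
            c₁ * (α * (r 0 / l 0) ^ 2 / (l 0 + α)) * ϑ) ∧
        (x ∈ Gset h₁ h₂ ρ η ϑ →
          c₂ * (α * (r 0 / l 0) ^ 2 / (l 0 + α)) * ϑ ^ 2 ≤
            divR2 (driftG h₁ h₂ l r α) x) := by
  have hL' := hL.ne'
  have hc₁ : ContDiff ℝ 2 (deriv h₁) := ContDiff.deriv' (n := 2) hreg₁
  have hc₂ : ContDiff ℝ 2 (deriv h₂) := ContDiff.deriv' (n := 2) hreg₂
  have hcc₁ : ContDiff ℝ 1 (deriv (deriv h₁)) := ContDiff.deriv' (n := 1) hc₁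
  have hcc₂ : ContDiff ℝ 1 (deriv (deriv h₂)) := ContDiff.deriv' (n := 1) hc₂
  have D₁ : Differentiable ℝ (deriv h₁) := hc₁.differentiable (by norm_num)
  have D₂ : Differentiable ℝ (deriv h₂) := hc₂.differentiable (by norm_num)
  obtain ⟨m₁, hm₁, z₁⟩ := exists_zeroControl hL' (hreg₁.of_le (by norm_num)) hper₁ hH1₁
  obtain ⟨m₂, hm₂, z₂⟩ := exists_zeroControl hL' (hreg₂.of_le (by norm_num)) hper₂ hH1₂
  obtain ⟨m₃, hm₃, z₃⟩ := exists_zeroControl hL' hc₁ hper₁.deriv' hH2₁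
  obtain ⟨m₄, hm₄, z₄⟩ := exists_zeroControl hL' hc₂ hper₂.deriv' hH2₂
  obtain ⟨m, hm, hm1, w₁, w₂, w₃, w₄⟩ : ∃ m : ℝ, 0 < m ∧ m ≤ 1 ∧ ZeroControl h₁ m ∧
      ZeroControl h₂ m ∧ ZeroControl (deriv h₁) m ∧ ZeroControl (deriv h₂) m := by
    refine ⟨min 1 (min (min m₁ m₂) (min m₃ m₄)), by positivity, min_le_left _ _, z₁.mono ?_,
      z₂.mono ?_, z₃.mono ?_, z₄.mono ?_⟩ <;> simp
  obtain ⟨K₁, hK₁⟩ := hper₁.deriv'.exists_abs_le hL' hc₁.continuous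
  obtain ⟨K₂, hK₂⟩ := hper₂.deriv'.exists_abs_le hL' hc₂.continuous
  obtain ⟨K₃, hK₃⟩ := hper₁.deriv'.deriv'.exists_abs_le hL' hcc₁.continuous
  obtain ⟨K₄, hK₄⟩ := hper₂.deriv'.deriv'.exists_abs_le hL' hcc₂.continuous
  obtain ⟨K, hK1, k₁, k₂, k₃, k₄⟩ : ∃ K : ℝ, 1 ≤ K ∧ (∀ x, |deriv h₁ x| ≤ K) ∧
      (∀ x, |deriv h₂ x| ≤ K) ∧ (∀ x, |deriv (deriv h₁) x| ≤ K) ∧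
      (∀ x, |deriv (deriv h₂) x| ≤ K) := by
    refine ⟨max 1 (max (max K₁ K₂) (max K₃ K₄)), le_max_left _ _, fun x => (hK₁ x).trans ?_,
      fun x => (hK₂ x).trans ?_, fun x => (hK₃ x).trans ?_, fun x => (hK₄ x).trans ?_⟩ <;> simp
  have hK0 : 0 < K := by linarith
  obtain ⟨c, C, hc, hC, hφ⟩ := driftCoeff_bounds hl₀ hr₀ (hlreg.of_le (by norm_num))
    (hrreg.of_le (by norm_num)) hlb hrb
  have h0 : (0 : ℝ) ∈ Set.Icc (-1 : ℝ) 1 := by norm_num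
  have hl0 : 0 < l 0 := hl₀.trans_le (hlb 0 h0)
  refine ⟨1, 1, 8 * C * K ^ 4, c * m ^ 4, min (m ^ 2) (c * m ^ 4 / (6 * C * K ^ 4)), one_pos,
    one_pos, by positivity, by positivity, by positivity, ?_⟩
  intro α hα ϑ hϑ hϑ1 η hη hηlt x
  obtain ⟨-, hηc⟩ := lt_min_iff.1 hηlt
  have hη1 : η < m ^ 2 * ϑ ^ 2 := hηc.trans_le (by gcongr; exact min_le_left _ _)
  have hη2 : η < c * m ^ 4 / (6 * C * K ^ 4) * ϑ ^ 2 :=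
    hηc.trans_le (by gcongr; exact min_le_right _ _)
  have hηϑ : η ≤ ϑ := by
    have : m ^ 2 ≤ 1 := pow_le_one₀ hm.le hm1
    nlinarith
  have hHabs : |Ham h₁ h₂ x| ≤ 1 := by
    rw [Ham, abs_mul]
    exact mul_le_one₀ (hbd₁ _) (abs_nonneg _) (hbd₂ _)
  obtain ⟨hlow, hup, d, hd, hdabs⟩ := hφ α hα _ (abs_le.1 hHabs)
  set A := α * (r 0 / l 0) ^ 2 / (l 0 + α) with hA
  have hA0 : 0 ≤ A := by positivity
  rw [divR2_driftG hreg₁ hreg₂ hd]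
  set φ := driftCoeff l r α (Ham h₁ h₂ x)
  have hφ0 : 0 ≤ φ := le_trans (by positivity) hlow
  have sq_bound : ∀ {t : ℝ}, |t| ≤ K → t ^ 2 ≤ K ^ 2 := fun h =>
    sq_le_sq' (abs_le.1 h).1 (abs_le.1 h).2
  have diff_bound : ∀ {a b e : ℝ}, |a| ≤ K → |b| ≤ 1 → |e| ≤ K → |a ^ 2 - b * e| ≤ 2 * K ^ 2 := by
    intro a b e ha hb he
    refine (abs_sub _ _).trans ?_
    rw [abs_mul, abs_of_nonneg (sq_nonneg a)]
    have : |b| * |e| ≤ 1 * K := by gcongr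
    nlinarith [sq_bound ha]
  have hQ : |deriv h₁ x.1 ^ 2 * (deriv h₂ x.2 ^ 2 - h₂ x.2 * deriv (deriv h₂) x.2) +
      deriv h₂ x.2 ^ 2 * (deriv h₁ x.1 ^ 2 - h₁ x.1 * deriv (deriv h₁) x.1)| ≤ 4 * K ^ 4 := by
    refine (abs_add_le _ _).trans ?_
    rw [abs_mul, abs_mul, abs_of_nonneg (sq_nonneg (deriv h₁ x.1)),
      abs_of_nonneg (sq_nonneg (deriv h₂ x.2))]
    calc _ ≤ K ^ 2 * (2 * K ^ 2) + K ^ 2 * (2 * K ^ 2) :=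
          add_le_add
            (mul_le_mul (sq_bound (k₁ _)) (diff_bound (k₂ _) (hbd₂ _) (k₄ _)) (abs_nonneg _)
              (by positivity))
            (mul_le_mul (sq_bound (k₂ _)) (diff_bound (k₁ _) (hbd₁ _) (k₃ _)) (abs_nonneg _)
              (by positivity))
      _ = 4 * K ^ 4 := by ring
  set Q := deriv h₁ x.1 ^ 2 * (deriv h₂ x.2 ^ 2 - h₂ x.2 * deriv (deriv h₂) x.2) +
      deriv h₂ x.2 ^ 2 * (deriv h₁ x.1 ^ 2 - h₁ x.1 * deriv (deriv h₁) x.1)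
  have hE : |deriv (deriv h₁) x.1 * deriv (deriv h₂) x.2| ≤ K ^ 4 := by
    rw [abs_mul]
    calc _ ≤ K * K := mul_le_mul (k₃ _) (k₄ _) (abs_nonneg _) hK0.le
      _ = K ^ 2 := by ring
      _ ≤ K ^ 4 := pow_le_pow_right₀ hK1 (by norm_num)
  set E := deriv (deriv h₁) x.1 * deriv (deriv h₂) x.2
  set P := deriv h₁ x.1 * deriv h₂ x.2 with hP
  have hsplit : d * (h₁ x.1 * h₂ x.2 * Q) + φ * (2 * P ^ 2 - 2 * (h₁ x.1 * h₂ x.2) * E) =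
      h₁ x.1 * h₂ x.2 * (d * Q - 2 * (φ * E)) + 2 * (φ * P ^ 2) := by ring
  rw [hsplit]
  have hrest : |d * Q - 2 * (φ * E)| ≤ 6 * (C * A * K ^ 4) := by
    refine (abs_sub _ _).trans ?_
    simp only [abs_mul, abs_two, abs_of_nonneg hφ0]
    have e1 : |d| * |Q| ≤ C * A * (4 * K ^ 4) := by gcongr
    have e2 : φ * |E| ≤ C * A * K ^ 4 := by gcongr
    linarith
  have herr : x ∈ Eset h₁ h₂ η →
      |h₁ x.1 * h₂ x.2 * (d * Q - 2 * (φ * E))| ≤ η * (6 * (C * A * K ^ 4)) := by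
    intro hx
    rw [abs_mul]
    exact mul_le_mul hx hrest (abs_nonneg _) hη.le
  constructor
  · intro hx
    simp only [Fset, Set.mem_iUnion] at hx
    obtain ⟨q, hq, hxE, hxq⟩ := hx
    rw [Metric.mem_ball, Prod.dist_eq, max_lt_iff, Real.dist_eq, Real.dist_eq] at hxq
    have hPabs : |P| ≤ K ^ 2 * ϑ := by
      rw [hP, abs_mul]
      rcases hq with ⟨-, h⟩ | ⟨h, -⟩
      · have := abs_deriv_sub_le D₂ k₄ x.2 q.2
        rw [h, sub_zero] at this
        calc _ ≤ K * (K * ϑ) := mul_le_mul (k₁ _)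
              (this.trans (mul_le_mul_of_nonneg_left hxq.2.le hK0.le)) (abs_nonneg _) hK0.le
          _ = _ := by ring
      · have := abs_deriv_sub_le D₁ k₃ x.1 q.1
        rw [h, sub_zero] at this
        calc _ ≤ K * ϑ * K := mul_le_mul
              (this.trans (mul_le_mul_of_nonneg_left hxq.1.le hK0.le)) (k₂ _) (abs_nonneg _)
              (by positivity)
          _ = _ := by ring
    have hP2 : P ^ 2 ≤ K ^ 4 * ϑ := by
      calc P ^ 2 ≤ (K ^ 2 * ϑ) ^ 2 := sq_le_sq' (abs_le.1 hPabs).1 (abs_le.1 hPabs).2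
        _ = K ^ 4 * (ϑ * ϑ) := by ring
        _ ≤ K ^ 4 * (ϑ * 1) := by gcongr
        _ = _ := by ring
    refine (abs_add_le _ _).trans ?_
    rw [abs_of_nonneg (show 0 ≤ 2 * (φ * P ^ 2) by positivity)]
    have e1 : φ * P ^ 2 ≤ C * A * (K ^ 4 * ϑ) := by gcongr
    have e2 : η * (6 * (C * A * K ^ 4)) ≤ ϑ * (6 * (C * A * K ^ 4)) := by gcongr
    linarith [herr hxE]
  · rintro ⟨⟨hxE, -⟩, hxF⟩
    have hfar : ∀ q ∈ midpoints h₁ h₂, |x.1 - q.1| < ϑ → ϑ ≤ |x.2 - q.2| := by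
      intro q hq h1
      by_contra! h2
      refine hxF (Set.mem_biUnion hq ⟨hxE, ?_⟩)
      rw [Metric.mem_ball, Prod.dist_eq, Real.dist_eq, Real.dist_eq]
      exact max_lt h1 h2
    have hPabs : m ^ 2 * ϑ ≤ |P| := by
      have hsmall : |h₁ x.1| < m * ϑ ∨ |h₂ x.2| < m * ϑ := by
        by_contra! h
        have := mul_le_mul h.1 h.2 (by positivity) (abs_nonneg _)
        rw [← abs_mul] at this
        have hx : |h₁ x.1 * h₂ x.2| ≤ η := hxE
        linarith
      rcases hsmall with h | h
      · exact le_abs_deriv_mul_deriv hm hϑ hϑ1 w₁ w₄ h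
          fun z e hz he => hfar (z, e) (Or.inl ⟨hz, he⟩)
      · rw [hP, mul_comm (deriv h₁ x.1)]
        refine le_abs_deriv_mul_deriv hm hϑ hϑ1 w₂ w₃ h fun z e hz he h1 => ?_
        by_contra! h2
        exact (hfar (e, z) (Or.inr ⟨he, hz⟩) h2).not_gt h1
    have hP2 : m ^ 4 * ϑ ^ 2 ≤ P ^ 2 := by
      calc m ^ 4 * ϑ ^ 2 = (m ^ 2 * ϑ) ^ 2 := by ring
        _ ≤ |P| ^ 2 := by gcongr
        _ = P ^ 2 := sq_abs P
    have e1 : c * A * (m ^ 4 * ϑ ^ 2) ≤ φ * P ^ 2 := by gcongr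
    have e2 : η * (6 * (C * A * K ^ 4)) ≤ c * A * (m ^ 4 * ϑ ^ 2) := by
      calc _ ≤ c * m ^ 4 / (6 * C * K ^ 4) * ϑ ^ 2 * (6 * (C * A * K ^ 4)) := by gcongr
        _ = _ := by field_simp
    linarith [(abs_le.1 (herr hxE)).1]
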